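/- Let $\beta_1, \ldots, \beta_k < 0$, $\alpha_n \to \infty$ with $n e^{\alpha_n \beta_1} \to \lambda \in (0, \infty)$. For each fixed $j \ge 0$, the quantity $\frac{\binom{n}{j} e^{\alpha_n\beta_1 j + \sum_{p=2}^k \alpha_n \beta_p j^p/n^{p-1}}}{\sum_{m=0}^{n} \binom{n}{m} e^{\alpha_n\beta_1 m + \sum_{p=2}^k \alpha_n \beta_p m^p/n^{p-1}}}$ converges to $e^{-\lambda} \lambda^j / j!$ as $n \to \infty$. -/

import Mathlib

open Real Filter Finset

/-- If `n * exp (a n * b)` converges to a positive limit and `b ≠ 0`, then `a n = o(n)`. -/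
lemma tendsto_div_natCast_of_tendsto_mul_exp {a : ℕ → ℝ} {b lam : ℝ} (hb : b ≠ 0) (hlam : 0 < lam)
    (h : Tendsto (fun n : ℕ => (n : ℝ) * Real.exp (a n * b)) atTop (nhds lam)) :
    Tendsto (fun n : ℕ => a n / n) atTop (nhds 0) := by
  have hlog : Tendsto (fun n : ℕ => Real.log n / n) atTop (nhds 0) :=
    (Real.isLittleO_log_id_atTop.tendsto_div_nhds_zero).comp tendsto_natCast_atTop_atTop
  have hx : Tendsto (fun n : ℕ => Real.log ((n : ℝ) * Real.exp (a n * b)) / n) atTop (nhds 0) :=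
    (h.log hlam.ne').div_atTop tendsto_natCast_atTop_atTop
  have hlim := (hx.sub hlog).div_const b
  rw [sub_zero, zero_div] at hlim
  refine hlim.congr' ?_
  filter_upwards [eventually_gt_atTop 0] with n hn
  have hn' : (n : ℝ) ≠ 0 := by positivity
  rw [Real.log_mul hn' (Real.exp_pos _).ne', Real.log_exp]
  field_simp
  ring

theorem stmt15 (k : ℕ) (hk : 1 ≤ k) (β : ℕ → ℝ)
    (hβ : ∀ p ∈ Finset.Icc 1 k, β p < 0)
    (α : ℕ → ℝ) (hα : Tendsto α atTop atTop)
    (lam : ℝ) (hlam : 0 < lam)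
    (h : Tendsto (fun n : ℕ => (n : ℝ) * Real.exp (α n * β 1)) atTop (nhds lam))
    (j : ℕ) :
    Tendsto (fun n : ℕ =>
        ((n.choose j : ℝ) * Real.exp (α n * β 1 * j +
            ∑ p ∈ Finset.Icc 2 k, α n * β p * (j : ℝ) ^ p / (n : ℝ) ^ (p - 1))) /
        (∑ m ∈ Finset.range (n + 1), (n.choose m : ℝ) *
            Real.exp (α n * β 1 * m +
              ∑ p ∈ Finset.Icc 2 k, α n * β p * (m : ℝ) ^ p / (n : ℝ) ^ (p - 1))))
      atTop (nhds (Real.exp (-lam) * lam ^ j / (Nat.factorial j))) := by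
  have hdiv := tendsto_div_natCast_of_tendsto_mul_exp
    (hβ 1 (Finset.mem_Icc.2 ⟨le_rfl, hk⟩)).ne hlam h
  have hcorr (m : ℕ) : Tendsto (fun n : ℕ =>
      ∑ p ∈ Finset.Icc 2 k, α n * β p * (m : ℝ) ^ p / (n : ℝ) ^ (p - 1)) atTop (nhds 0) := by
    rw [← Finset.sum_const_zero (s := Finset.Icc 2 k)]
    refine tendsto_finsetSum _ fun p hp => ?_
    obtain ⟨r, rfl⟩ := Nat.exists_eq_add_of_le (Finset.mem_Icc.1 hp).1
    have hr : Tendsto (fun n : ℕ => α n / n * (β (2 + r) * (m : ℝ) ^ (2 + r)) *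
        ((n : ℝ)⁻¹) ^ r) atTop (nhds 0) := by
      simpa using (hdiv.mul_const (β (2 + r) * (m : ℝ) ^ (2 + r))).mul
        ((tendsto_inv_atTop_nhds_zero_nat (𝕜 := ℝ)).pow r)
    refine hr.congr fun n => ?_
    rw [show 2 + r - 1 = r + 1 by omega, pow_succ, inv_pow, div_eq_mul_inv, div_eq_mul_inv,
      mul_inv]
    ring
  have hexp (n m : ℕ) : Real.exp (α n * β 1 * m +
        ∑ p ∈ Finset.Icc 2 k, α n * β p * (m : ℝ) ^ p / (n : ℝ) ^ (p - 1)) =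
      Real.exp (α n * β 1) ^ m *
        Real.exp (∑ p ∈ Finset.Icc 2 k, α n * β p * (m : ℝ) ^ p / (n : ℝ) ^ (p - 1)) := by
    rw [Real.exp_add, ← Real.exp_nat_mul, mul_comm (m : ℝ)]
  have hterm (m : ℕ) : Tendsto (fun n : ℕ => (n.choose m : ℝ) * Real.exp (α n * β 1 * m +
        ∑ p ∈ Finset.Icc 2 k, α n * β p * (m : ℝ) ^ p / (n : ℝ) ^ (p - 1)))
      atTop (nhds (lam ^ m / m.factorial)) := by
    have := (ProbabilityTheory.tendsto_choose_mul_pow_atTop m h).mul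
      ((Real.continuous_exp.tendsto 0).comp (hcorr m))
    rw [Real.exp_zero, mul_one] at this
    refine this.congr fun n => ?_
    rw [hexp, mul_assoc, Function.comp_apply]
  have hsum : Tendsto (fun n : ℕ => ∑' m : ℕ, (n.choose m : ℝ) * Real.exp (α n * β 1 * m +
        ∑ p ∈ Finset.Icc 2 k, α n * β p * (m : ℝ) ^ p / (n : ℝ) ^ (p - 1)))
      atTop (nhds (∑' m : ℕ, lam ^ m / m.factorial)) := by
    refine tendsto_tsum_of_dominated_convergence
      (Real.summable_pow_div_factorial (lam + 1)) hterm ?_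
    filter_upwards [hα.eventually_ge_atTop 0, h.eventually_le_const (lt_add_one lam)]
      with n hαn hn m
    have hnonpos : ∑ p ∈ Finset.Icc 2 k, α n * β p * (m : ℝ) ^ p / (n : ℝ) ^ (p - 1) ≤ 0 := by
      refine Finset.sum_nonpos fun p hp => ?_
      have hp' := Finset.mem_Icc.1 hp
      have hβp := hβ p (Finset.mem_Icc.2 ⟨by omega, hp'.2⟩)
      exact div_nonpos_of_nonpos_of_nonneg (mul_nonpos_of_nonpos_of_nonneg
        (mul_nonpos_of_nonneg_of_nonpos hαn hβp.le) (by positivity)) (by positivity)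
    rw [Real.norm_of_nonneg (by positivity), hexp]
    calc (n.choose m : ℝ) * (Real.exp (α n * β 1) ^ m * Real.exp
          (∑ p ∈ Finset.Icc 2 k, α n * β p * (m : ℝ) ^ p / (n : ℝ) ^ (p - 1)))
        ≤ (n : ℝ) ^ m / m.factorial * (Real.exp (α n * β 1) ^ m * 1) := by
          gcongr
          · exact Nat.choose_le_pow_div m n
          · exact Real.exp_le_one_iff.2 hnonpos
      _ = ((n : ℝ) * Real.exp (α n * β 1)) ^ m / m.factorial := by rw [mul_pow]; ring
      _ ≤ (lam + 1) ^ m / m.factorial := by gcongr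
  have htsum : ∑' m : ℕ, lam ^ m / m.factorial = Real.exp lam := by
    rw [Real.exp_eq_exp_ℝ]
    exact (NormedSpace.expSeries_div_hasSum_exp lam).tsum_eq
  rw [htsum] at hsum
  have hlim := (hterm j).div hsum (Real.exp_pos lam).ne'
  rw [show Real.exp (-lam) * lam ^ j / (Nat.factorial j) =
    lam ^ j / (Nat.factorial j) / Real.exp lam by rw [Real.exp_neg]; ring]
  refine hlim.congr fun n => ?_
  rw [Pi.div_apply, tsum_eq_sum (s := Finset.range (n + 1))]
  intro m hm
  have hnm : n < m := not_le.1 fun hmn => hm (Finset.mem_range_succ_iff.2 hmn)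
  rw [Nat.choose_eq_zero_of_lt hnm, Nat.cast_zero, zero_mul]
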